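/- Let (𝒜, α) be a weighted system with 𝒜 = {A_1, …, A_m}, and let S be a finite set of nonempty finite words over the alphabet {1, …, m} with the cut-set property: every infinite sequence of letters from {1, …, m} has a prefix belonging to S. For a word w = (i_1, …, i_k), write Π_w = A_{i_k}⋯A_{i_1} and |w| = α_{i_1} + ⋯ + α_{i_k}. If there exists λ > 0 such that ‖Π_w‖ < λ^{|w|} for every w ∈ S, then ρ(𝒜, α) < λ. -/

import Mathlib

open Filter

attribute [local instance] Matrix.linftyOpNormedRing

/-- The product `A(k)⋯A(1)` associated with the word `w = (i_1, …, i_k)`. -/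
noncomputable def wordProd {d m : ℕ} (A : Fin m → Matrix (Fin d) (Fin d) ℝ)
    (w : List (Fin m)) : Matrix (Fin d) (Fin d) ℝ :=
  ((w.map A).reverse).prod

/-- The total weight `α(k)+⋯+α(1)` of the word `w = (i_1, …, i_k)`. -/
def wordWeight {m : ℕ} (α : Fin m → ℝ) (w : List (Fin m)) : ℝ :=
  (w.map α).sum

/-- `ρ_k`: the maximum of `‖A(k)⋯A(1)‖^(1/(α(k)+⋯+α(1)))` over products of length `k`. -/
noncomputable def rhoSeq {d m : ℕ} (A : Fin m → Matrix (Fin d) (Fin d) ℝ)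
    (α : Fin m → ℝ) (k : ℕ) : ℝ :=
  sSup {r : ℝ | ∃ w : List (Fin m), w.length = k ∧
    r = ‖wordProd A w‖ ^ (1 / wordWeight α w)}

/-- The `α`-weighted joint spectral radius `ρ(𝒜, α) = limsup_{k→∞} ρ_k`. -/
noncomputable def wjsr {d m : ℕ} (A : Fin m → Matrix (Fin d) (Fin d) ℝ)
    (α : Fin m → ℝ) : ℝ :=
  limsup (rhoSeq A α) atTop

theorem wordProd_append {d m : ℕ} (A : Fin m → Matrix (Fin d) (Fin d) ℝ)
    (s v : List (Fin m)) : wordProd A (s ++ v) = wordProd A v * wordProd A s := by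
  simp [wordProd]

theorem wordWeight_append {m : ℕ} (α : Fin m → ℝ) (s v : List (Fin m)) :
    wordWeight α (s ++ v) = wordWeight α s + wordWeight α v := by
  simp [wordWeight]

theorem length_mul_le_wordWeight {m : ℕ} {α : Fin m → ℝ} {a : ℝ} (ha : ∀ i, a ≤ α i)
    (w : List (Fin m)) : w.length * a ≤ wordWeight α w := by
  induction w with
  | nil => simp [wordWeight]
  | cons i w ih =>
    have h := ha i
    simp only [wordWeight, List.map_cons, List.sum_cons, List.length_cons] at ih ⊢
    push_cast
    linarith

/-- A strict exponential bound on finitely many words persists for a slightly smaller rate. -/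
theorem exists_rate_lt_of_norm_lt {d m : ℕ} (A : Fin m → Matrix (Fin d) (Fin d) ℝ)
    (α : Fin m → ℝ) (S : Finset (List (Fin m))) {lam : ℝ} (hlam : 0 < lam)
    (hS : ∀ w ∈ S, ‖wordProd A w‖ < lam ^ wordWeight α w) :
    ∃ μ, 0 < μ ∧ μ < lam ∧ ∀ w ∈ S, ‖wordProd A w‖ ≤ μ ^ wordWeight α w := by
  have hev : ∀ᶠ μ in nhds lam, ∀ w ∈ S, ‖wordProd A w‖ < μ ^ wordWeight α w := by
    rw [Filter.eventually_all_finset]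
    intro w hw
    exact (Real.continuousAt_rpow_const lam _ (Or.inl hlam.ne')).eventually_const_lt (hS w hw)
  have h : ∀ᶠ μ in nhdsWithin lam (Set.Iio lam),
      (∀ w ∈ S, ‖wordProd A w‖ < μ ^ wordWeight α w) ∧ 0 < μ ∧ μ < lam :=
    (hev.filter_mono nhdsWithin_le_nhds).and
      (((eventually_gt_nhds hlam).filter_mono nhdsWithin_le_nhds).and self_mem_nhdsWithin)
  obtain ⟨μ, hμS, hμ, hμl⟩ := h.exists
  exact ⟨μ, hμ, hμl, fun w hw => (hμS w hw).le⟩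

/-- Every word that is long enough starts with a word of the cut set. -/
theorem exists_append_of_cut_set {m : ℕ} (hm : 0 < m) {S : Finset (List (Fin m))}
    (hcut : ∀ u : ℕ → Fin m, ∃ k : ℕ, (List.ofFn fun j : Fin k => u j) ∈ S)
    {w : List (Fin m)} (hw : ∀ s ∈ S, s.length ≤ w.length) :
    ∃ s ∈ S, ∃ v, w = s ++ v := by
  obtain ⟨k, hk⟩ := hcut fun j => w.getD j ⟨0, hm⟩
  have hkw : k ≤ w.length := by simpa using hw _ hk
  refine ⟨_, hk, w.drop k, ?_⟩
  have htake : (List.ofFn fun j : Fin k => w.getD j ⟨0, hm⟩) = w.take k := by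
    apply List.ext_getElem
    · simpa using hkw
    · intro j hj _
      have hjk : j < k := by simpa using hj
      simp [List.getElem?_eq_getElem (hjk.trans_le hkw)]
  rw [htake, List.take_append_drop]

/-- An exponential bound on a cut set extends to all words, up to a constant factor. -/
theorem exists_norm_wordProd_le_of_cut_set {d m : ℕ} (hm : 0 < m)
    (A : Fin m → Matrix (Fin d) (Fin d) ℝ) (α : Fin m → ℝ) {S : Finset (List (Fin m))}
    (hne : ∀ w ∈ S, w ≠ [])
    (hcut : ∀ u : ℕ → Fin m, ∃ k : ℕ, (List.ofFn fun j : Fin k => u j) ∈ S)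
    {μ : ℝ} (hμ : 0 < μ) (hS : ∀ w ∈ S, ‖wordProd A w‖ ≤ μ ^ wordWeight α w) :
    ∃ K, ∀ w, ‖wordProd A w‖ ≤ K * μ ^ wordWeight α w := by
  set L := S.sup List.length
  obtain ⟨K, hK⟩ := ((List.finite_length_le (Fin m) L).image
    fun w => ‖wordProd A w‖ / μ ^ wordWeight α w).bddAbove
  have hshort : ∀ w : List (Fin m), w.length ≤ L →
      ‖wordProd A w‖ ≤ K * μ ^ wordWeight α w := fun w hw =>
    (div_le_iff₀ (Real.rpow_pos_of_pos hμ _)).1 (hK ⟨w, hw, rfl⟩)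
  refine ⟨K, fun w => ?_⟩
  induction hn : w.length using Nat.strong_induction_on generalizing w with
  | _ n ih =>
    rcases le_total w.length L with hw | hw
    · exact hshort w hw
    obtain ⟨s, hs, v, rfl⟩ :=
      exists_append_of_cut_set hm hcut fun s hs => (Finset.le_sup hs).trans hw
    have hspos := List.length_pos_iff.2 (hne s hs)
    have hv := ih v.length (by rw [← hn, List.length_append]; omega) v rfl
    calc ‖wordProd A (s ++ v)‖ ≤ ‖wordProd A v‖ * ‖wordProd A s‖ := by
          rw [wordProd_append]
          exact norm_mul_le _ _
      _ ≤ (K * μ ^ wordWeight α v) * μ ^ wordWeight α s :=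
          mul_le_mul hv (hS s hs) (norm_nonneg _) ((norm_nonneg _).trans hv)
      _ = K * μ ^ wordWeight α (s ++ v) := by
          rw [wordWeight_append, Real.rpow_add hμ]
          ring

theorem rhoSeq_nonneg {d m : ℕ} (A : Fin m → Matrix (Fin d) (Fin d) ℝ)
    (α : Fin m → ℝ) (k : ℕ) : 0 ≤ rhoSeq A α k := by
  apply Real.sSup_nonneg
  rintro _ ⟨w, -, rfl⟩
  exact Real.rpow_nonneg (norm_nonneg _) _

/-- The exponential rate of a uniform bound dominates the weighted joint spectral radius. -/
theorem wjsr_le_of_norm_wordProd_le {d m : ℕ} (hm : 0 < m)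
    (A : Fin m → Matrix (Fin d) (Fin d) ℝ) {α : Fin m → ℝ} (hα : ∀ i, 0 < α i)
    {K μ ν : ℝ} (hμ : 0 < μ) (hμν : μ < ν)
    (hK : ∀ w, ‖wordProd A w‖ ≤ K * μ ^ wordWeight α w) : wjsr A α ≤ ν := by
  have hν : 0 < ν := hμ.trans hμν
  have : Nonempty (Fin m) := ⟨⟨0, hm⟩⟩
  obtain ⟨i₀, hi₀⟩ := Finite.exists_min α
  have hq : 1 < ν / μ := (one_lt_div hμ).2 hμν
  have htend : Tendsto (fun k : ℕ => (ν / μ) ^ ((k : ℝ) * α i₀)) atTop atTop :=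
    (tendsto_rpow_atTop_of_base_gt_one _ hq).comp
      (tendsto_natCast_atTop_atTop.atTop_mul_const (hα i₀))
  refine limsup_le_of_le
    (isCoboundedUnder_le_of_le atTop (x := 0) (rhoSeq_nonneg A α)) ?_
  filter_upwards [htend.eventually_ge_atTop K, eventually_gt_atTop 0] with k hk hk0
  refine Real.sSup_le ?_ hν.le
  rintro _ ⟨w, rfl, rfl⟩
  have hlen := length_mul_le_wordWeight hi₀ w
  have hpos : 0 < wordWeight α w :=
    (mul_pos (Nat.cast_pos.2 hk0) (hα i₀)).trans_le hlen
  have hKq : K ≤ (ν / μ) ^ wordWeight α w :=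
    hk.trans (Real.rpow_le_rpow_of_exponent_le hq.le hlen)
  rw [one_div, Real.rpow_inv_le_iff_of_pos (norm_nonneg _) hν.le hpos]
  calc ‖wordProd A w‖ ≤ K * μ ^ wordWeight α w := hK w
    _ ≤ (ν / μ) ^ wordWeight α w * μ ^ wordWeight α w := by gcongr
    _ = ν ^ wordWeight α w := by
        rw [← Real.mul_rpow (div_nonneg hν.le hμ.le) hμ.le, div_mul_cancel₀ _ hμ.ne']

/-- **Proposition 2.13.** If `S` is a cut set — a finite set of nonempty words
such that every infinite switching sequence has a prefix in `S` — and
`‖Π_w‖ < λ^{|w|}` for every `w ∈ S`, then `ρ(𝒜, α) < λ`. -/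
theorem wjsr_lt_of_cut_set {d m : ℕ} (hm : 0 < m)
    (A : Fin m → Matrix (Fin d) (Fin d) ℝ)
    (α : Fin m → ℝ) (hα : ∀ i, 0 < α i)
    (S : Finset (List (Fin m)))
    (hne : ∀ w ∈ S, w ≠ [])
    (hcut : ∀ u : ℕ → Fin m, ∃ k : ℕ, (List.ofFn fun j : Fin k => u j) ∈ S)
    (lam : ℝ) (hlam : 0 < lam)
    (hS : ∀ w ∈ S, ‖wordProd A w‖ < lam ^ wordWeight α w) :
    wjsr A α < lam := by
  obtain ⟨μ, hμ, hμl, hμS⟩ := exists_rate_lt_of_norm_lt A α S hlam hS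
  obtain ⟨K, hK⟩ := exists_norm_wordProd_le_of_cut_set hm A α hne hcut hμ hμS
  obtain ⟨ν, hμν, hνl⟩ := exists_between hμl
  exact (wjsr_le_of_norm_wordProd_le hm A hα hμ hμν hK).trans_lt hνl
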